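/- arXiv:2406.03482 — 3 statements merged into one kernel-verified Lean document; each statement's English description precedes it below -/
import Mathlib

section
/- Let d ≥ 1, let s ∈ ℝ^d be a random vector with i.i.d. standard Gaussian N(0,1) entries, and let q, k ∈ ℝ^d with k ≠ 0. Then E[⟨s, q⟩ · sign(⟨s, k⟩)] = √(2/π) · ⟨q, k⟩ / ‖k‖₂, where sign(x) = 1 if x > 0 and −1 if x < 0. Equivalently, E[√(π/2) · ‖k‖₂ · ⟨s, q⟩ · sign(⟨s, k⟩)] = ⟨q, k⟩. -/
open MeasureTheory ProbabilityTheory Real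

/-- Product measure on `ℝ^d` with i.i.d. standard Gaussian `N(0,1)` coordinates. -/
noncomputable def stdGaussianVec (d : ℕ) : Measure (Fin d → ℝ) :=
  Measure.pi fun _ => gaussianReal 0 1

/-- Euclidean inner product on `ℝ^d`. -/
def iprod {d : ℕ} (u v : Fin d → ℝ) : ℝ := ∑ i, u i * v i

/-- Euclidean norm on `ℝ^d`. -/
noncomputable def nrm {d : ℕ} (u : Fin d → ℝ) : ℝ := Real.sqrt (∑ i, (u i) ^ 2)

/-- Sign function: `1` if `x > 0` and `-1` if `x < 0` (the value at `0` is immaterial). -/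
noncomputable def sgn (x : ℝ) : ℝ := if 0 < x then 1 else -1

open scoped RealInnerProductSpace NNReal

/-- The first absolute moment of a centered real Gaussian. -/
theorem integral_abs_gaussianReal (v : ℝ≥0) :
    ∫ x, |x| ∂(gaussianReal 0 v) = √(2 / π) * √v := by
  rcases eq_or_ne v 0 with rfl | hv
  · simp
  have hv' : (0 : ℝ) < v := by positivity
  have hmoment : ∫ x in Set.Ioi (0 : ℝ), x * rexp (-(2 * (v : ℝ))⁻¹ * x ^ 2) = v := by
    have h := integral_rpow_mul_exp_neg_mul_rpow (p := 2) (q := 1) (b := (2 * (v : ℝ))⁻¹)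
      (by norm_num) (by norm_num) (by positivity)
    norm_num [Real.rpow_neg_one] at h
    have hcancel : 2 * (v : ℝ) * 2⁻¹ = v := by ring
    simpa [hcancel] using h
  calc ∫ x, |x| ∂(gaussianReal 0 v)
      = ∫ x, (√(2 * π * v))⁻¹ * (|x| * rexp (-(2 * (v : ℝ))⁻¹ * |x| ^ 2)) := by
        rw [integral_gaussianReal_eq_integral_smul hv]
        congr with x
        rw [gaussianPDFReal, sub_zero, sq_abs, smul_eq_mul, neg_div, div_eq_inv_mul (x ^ 2)]
        ring_nf
    _ = (√(2 * π * v))⁻¹ * (2 * v) := by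
        rw [integral_const_mul,
          integral_comp_abs (f := fun x => x * rexp (-(2 * (v : ℝ))⁻¹ * x ^ 2)), hmoment]
    _ = √(2 / π) * √v := by
        rw [Real.sqrt_mul (by positivity), Real.sqrt_mul (by positivity),
          Real.sqrt_div (by positivity)]
        have h2 := Real.mul_self_sqrt (show (0 : ℝ) ≤ 2 by norm_num)
        have h3 := Real.mul_self_sqrt hv'.le
        field_simp
        nlinarith

theorem mul_sgn_self (x : ℝ) : x * sgn x = |x| := by
  unfold sgn
  split_ifs with h
  · rw [mul_one, abs_of_pos h]
  · rw [mul_neg_one, abs_of_nonpos (not_lt.mp h)]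

theorem measurable_sgn : Measurable sgn :=
  Measurable.ite measurableSet_Ioi measurable_const measurable_const

theorem abs_sgn_le_one (x : ℝ) : |sgn x| ≤ 1 := by
  unfold sgn
  split_ifs <;> simp

section InnerProductSpace

variable {E : Type*} [NormedAddCommGroup E] [InnerProductSpace ℝ E] [FiniteDimensional ℝ E]
  [MeasurableSpace E] [BorelSpace E]

theorem integrable_inner_mul_sgn_inner_stdGaussian (q k : E) :
    Integrable (fun s => ⟪q, s⟫ * sgn ⟪k, s⟫) (stdGaussian E) := by
  have hq : Integrable (fun s => ⟪q, s⟫) (stdGaussian E) :=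
    IsGaussian.integrable_id.const_inner q
  refine hq.mul_bdd (c := 1) ?_ (ae_of_all _ fun s => abs_sgn_le_one _)
  exact (measurable_sgn.comp (by fun_prop)).aestronglyMeasurable

theorem integral_abs_inner_stdGaussian (k : E) :
    ∫ s, |⟪k, s⟫| ∂(stdGaussian E) = √(2 / π) * ‖k‖ := by
  have hmap : (stdGaussian E).map (innerSL ℝ k) = gaussianReal 0 (‖k‖ ^ 2).toNNReal := by
    rw [IsGaussian.map_eq_gaussianReal, integral_strongDual_stdGaussian,
      variance_dual_stdGaussian, innerSL_apply_norm]
  calc ∫ s, |⟪k, s⟫| ∂(stdGaussian E)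
      = ∫ x, |x| ∂((stdGaussian E).map (innerSL ℝ k)) := by
        rw [integral_map (by fun_prop) (by fun_prop)]
        rfl
    _ = √(2 / π) * ‖k‖ := by
        rw [hmap, integral_abs_gaussianReal, Real.coe_toNNReal _ (by positivity),
          Real.sqrt_sq (norm_nonneg k)]

/-- The reflection in the line spanned by `k` preserves the Gaussian measure and `⟪k, ·⟫`, and
flips the sign of `⟪w, ·⟫`. -/
theorem integral_inner_mul_sgn_inner_stdGaussian_of_orthogonal {w k : E} (h : ⟪k, w⟫ = 0) :
    ∫ s, ⟪w, s⟫ * sgn ⟪k, s⟫ ∂(stdGaussian E) = 0 := by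
  let R := (ℝ ∙ k).reflection
  have hinner (u s : E) : ⟪u, R s⟫ = ⟪R u, s⟫ := by
    rw [← R.inner_map_map, Submodule.reflection_reflection]
  have hk : R k = k :=
    Submodule.reflection_mem_subspace_eq_self (Submodule.mem_span_singleton_self k)
  have hw : R w = -w :=
    Submodule.reflection_mem_subspace_orthogonalComplement_eq_neg
      (Submodule.mem_orthogonal_singleton_iff_inner_right.mpr h)
  have hneg : ∫ s, ⟪w, s⟫ * sgn ⟪k, s⟫ ∂(stdGaussian E)
      = -∫ s, ⟪w, s⟫ * sgn ⟪k, s⟫ ∂(stdGaussian E) := by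
    conv_lhs => rw [← stdGaussian_map R]
    have hR : MeasurableEmbedding R := R.toHomeomorph.measurableEmbedding
    rw [hR.integral_map, ← integral_neg]
    congr with s
    simp [hinner, hk, hw]
  linarith

theorem integral_inner_mul_sgn_inner_stdGaussian (q : E) {k : E} (hk : k ≠ 0) :
    ∫ s, ⟪q, s⟫ * sgn ⟪k, s⟫ ∂(stdGaussian E) = √(2 / π) * ⟪q, k⟫ / ‖k‖ := by
  have hk' : ‖k‖ ≠ 0 := norm_ne_zero_iff.mpr hk
  set c := ⟪q, k⟫ / ‖k‖ ^ 2 with hc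
  set w := q - c • k with hw
  have horth : ⟪k, w⟫ = 0 := by
    rw [hw, inner_sub_right, inner_smul_right, real_inner_self_eq_norm_sq, real_inner_comm, hc]
    field_simp
    ring
  calc ∫ s, ⟪q, s⟫ * sgn ⟪k, s⟫ ∂(stdGaussian E)
      = ∫ s, (c * |⟪k, s⟫| + ⟪w, s⟫ * sgn ⟪k, s⟫) ∂(stdGaussian E) := by
        congr with s
        rw [← mul_sgn_self, hw, inner_sub_left, real_inner_smul_left]
        ring
    _ = c * (√(2 / π) * ‖k‖) := by
        have habs : Integrable (fun s => |⟪k, s⟫|) (stdGaussian E) :=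
          (IsGaussian.integrable_id.const_inner k).abs
        rw [integral_add (habs.const_mul c) (integrable_inner_mul_sgn_inner_stdGaussian w k),
          integral_const_mul, integral_abs_inner_stdGaussian,
          integral_inner_mul_sgn_inner_stdGaussian_of_orthogonal horth, add_zero]
    _ = √(2 / π) * ⟪q, k⟫ / ‖k‖ := by
        rw [hc]
        field_simp

end InnerProductSpace

theorem iprod_comm {d : ℕ} (u v : Fin d → ℝ) : iprod u v = iprod v u := by
  simp only [iprod, mul_comm]

theorem inner_toLp_eq_iprod {d : ℕ} (u v : Fin d → ℝ) :
    ⟪WithLp.toLp 2 u, WithLp.toLp 2 v⟫ = iprod u v := by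
  simp [iprod, PiLp.inner_apply, mul_comm]

theorem norm_toLp_eq_nrm {d : ℕ} (u : Fin d → ℝ) : ‖WithLp.toLp 2 u‖ = nrm u := by
  simp [nrm, EuclideanSpace.norm_eq]

/-- Single-row unbiasedness: `E[⟨s, q⟩ · sign(⟨s, k⟩)] = √(2/π) · ⟨q, k⟩ / ‖k‖₂`. -/
theorem qjl_single_row_unbiased (d : ℕ) (hd : 1 ≤ d) (q k : Fin d → ℝ) (hk : k ≠ 0) :
    ∫ s, iprod s q * sgn (iprod s k) ∂(stdGaussianVec d)
      = Real.sqrt (2 / Real.pi) * iprod q k / nrm k := by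
  have h := integral_inner_mul_sgn_inner_stdGaussian (WithLp.toLp 2 q) (k := WithLp.toLp 2 k)
    (by simpa using hk)
  have htoLp : MeasurableEmbedding (WithLp.toLp 2 : (Fin d → ℝ) → EuclideanSpace ℝ (Fin d)) :=
    (MeasurableEquiv.toLp 2 (Fin d → ℝ)).measurableEmbedding
  rw [← map_pi_eq_stdGaussian, htoLp.integral_map] at h
  simp only [inner_toLp_eq_iprod, norm_toLp_eq_nrm] at h
  rw [stdGaussianVec, ← h]
  congr with s
  rw [iprod_comm s q, iprod_comm s k]
end

section
/- Let d ≥ 1, let s ∈ ℝ^d have i.i.d. standard Gaussian N(0,1) entries, let q, k ∈ ℝ^d with k ≠ 0, and define z := √(π/2) · ‖k‖₂ · ⟨s, q⟩ · sign(⟨s, k⟩). Then for every natural number ℓ ≥ 1, E[|z|^ℓ] = (√π · ‖k‖₂ · ‖q‖₂)^ℓ · Γ((ℓ+1)/2) / √π, where Γ is the Gamma function. -/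
open MeasureTheory ProbabilityTheory Real

/-- Absolute moments of the standard Gaussian distribution. -/
theorem integral_abs_pow_gaussianReal (n : ℕ) :
    ∫ x, |x| ^ n ∂(gaussianReal 0 1)
      = √2 ^ n * Real.Gamma (((n : ℝ) + 1) / 2) / √π := by
  have h_gamma := integral_rpow_mul_exp_neg_mul_rpow (p := 2) (q := n) (b := 1 / 2)
    two_pos (by linarith [n.cast_nonneg (α := ℝ)]) (by norm_num)
  have h_two : (1 / 2 : ℝ) ^ (-((n : ℝ) + 1) / 2) = √2 ^ n * √2 := by
    rw [one_div, Real.inv_rpow two_pos.le, ← Real.rpow_neg two_pos.le, ← pow_succ,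
      Real.sqrt_eq_rpow, ← Real.rpow_mul_natCast two_pos.le]
    congr 1
    push_cast
    ring
  have h_abs := integral_comp_abs (f := fun x : ℝ => x ^ n * Real.exp (-(1 / 2) * x ^ 2))
  rw [h_two] at h_gamma
  simp only [Real.rpow_natCast, Real.rpow_ofNat] at h_gamma
  rw [h_gamma] at h_abs
  rw [integral_gaussianReal_eq_integral_smul one_ne_zero]
  have h_density (x : ℝ) : gaussianPDFReal 0 1 x • |x| ^ n
      = (√(2 * π))⁻¹ * (|x| ^ n * Real.exp (-(1 / 2) * |x| ^ 2)) := by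
    rw [gaussianPDFReal, smul_eq_mul, sq_abs]
    simp only [NNReal.coe_one, mul_one, sub_zero]
    rw [show -x ^ 2 / 2 = -(1 / 2) * x ^ 2 by ring]
    ring
  simp_rw [h_density]
  rw [integral_const_mul, h_abs, Real.sqrt_mul two_pos.le]
  have : √2 ≠ 0 := by positivity
  have : √π ≠ 0 := by positivity
  field_simp

/-- A linear functional of a standard Gaussian vector is a scaled standard Gaussian. -/
theorem map_iprod_stdGaussianVec {d : ℕ} (q : Fin d → ℝ) :
    (stdGaussianVec d).map (fun s => iprod s q) = (gaussianReal 0 1).map (nrm q * ·) := by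
  let L := innerSL ℝ (WithLp.toLp 2 q)
  have h_comp : (fun s => iprod s q) = L ∘ WithLp.toLp 2 := by
    ext s
    simp [L, iprod, PiLp.inner_apply]
  have h_norm : ‖L‖ = nrm q := by
    simp [L, nrm, EuclideanSpace.norm_eq]
  rw [h_comp, ← Measure.map_map (by fun_prop) (by fun_prop), stdGaussianVec,
    map_pi_eq_stdGaussian, IsGaussian.map_eq_gaussianReal, integral_strongDual_stdGaussian,
    variance_dual_stdGaussian, gaussianReal_map_const_mul, h_norm]
  congr 1
  · simp
  · ext
    simp [sq_nonneg]

theorem abs_sgn (x : ℝ) : |sgn x| = 1 := by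
  unfold sgn
  split_ifs <;> simp

/-- Exact moments of the single-row QJL estimator term
`z = √(π/2) · ‖k‖₂ · ⟨s, q⟩ · sign(⟨s, k⟩)`:
`E[|z|^ℓ] = (√π · ‖k‖₂ · ‖q‖₂)^ℓ · Γ((ℓ+1)/2) / √π` for every `ℓ ≥ 1`. -/
theorem qjl_single_row_moments (d : ℕ) (hd : 1 ≤ d) (q k : Fin d → ℝ) (hk : k ≠ 0)
    (ℓ : ℕ) (hℓ : 1 ≤ ℓ) :
    ∫ s, |Real.sqrt (Real.pi / 2) * nrm k * iprod s q * sgn (iprod s k)| ^ ℓ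
        ∂(stdGaussianVec d)
      = (Real.sqrt Real.pi * nrm k * nrm q) ^ ℓ
          * Real.Gamma (((ℓ : ℝ) + 1) / 2) / Real.sqrt Real.pi := by
  have h_nonneg (u : Fin d → ℝ) : 0 ≤ nrm u := Real.sqrt_nonneg _
  have h_meas : Measurable fun s : Fin d → ℝ => iprod s q := by
    unfold iprod
    fun_prop
  have h_moment : ∫ s, |iprod s q| ^ ℓ ∂(stdGaussianVec d)
      = nrm q ^ ℓ * ∫ x, |x| ^ ℓ ∂(gaussianReal 0 1) := by
    rw [← integral_map (f := fun x : ℝ => |x| ^ ℓ) h_meas.aemeasurable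
        (by fun_prop), map_iprod_stdGaussianVec,
      integral_map (by fun_prop) (by fun_prop)]
    simp_rw [abs_mul, mul_pow, abs_of_nonneg (h_nonneg q)]
    rw [integral_const_mul]
  simp_rw [abs_mul, abs_sgn, mul_one, mul_pow, abs_of_nonneg (h_nonneg k),
    abs_of_nonneg (Real.sqrt_nonneg _)]
  rw [integral_const_mul, h_moment, integral_abs_pow_gaussianReal]
  have h_sqrt : √(π / 2) ^ ℓ * √2 ^ ℓ = √π ^ ℓ := by
    rw [← mul_pow, ← Real.sqrt_mul (by positivity), div_mul_cancel₀ _ two_ne_zero]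
  rw [← h_sqrt]
  ring
end

section
/- For every natural number ℓ ≥ 2, (√π)^{ℓ−2} · Γ((ℓ+1)/2) / Γ(3/2) ≤ (2/3)^{ℓ−2} · ℓ!/2, where Γ is the Gamma function. -/
/-- The moment bound with the exponent shifted by two, so that no truncated subtraction occurs. -/
theorem sqrt_pi_pow_mul_Gamma_le (m : ℕ) :
    √Real.pi ^ m * Real.Gamma (((m : ℝ) + 3) / 2) / Real.Gamma (3 / 2)
      ≤ (2 / 3 : ℝ) ^ m * (m + 2).factorial / 2 := by
  have hG : Real.Gamma (3 / 2) = √Real.pi / 2 := by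
    rw [show (3 / 2 : ℝ) = 1 / 2 + 1 by norm_num, Real.Gamma_add_one (by norm_num),
      Real.Gamma_one_half_eq]
    ring
  have hpi : 0 < √Real.pi := Real.sqrt_pos.mpr Real.pi_pos
  induction m using Nat.twoStepInduction with
  | zero =>
    have : √Real.pi / 2 ≠ 0 := by positivity
    simp [hG, this]
  | one =>
    rw [hG, show (((1 : ℕ) : ℝ) + 3) / 2 = 2 by norm_num, Real.Gamma_two]
    apply le_of_eq
    field_simp
    norm_num [Nat.factorial]
  | more m ih _ =>
    have hrec : Real.Gamma ((((m + 2 : ℕ) : ℝ) + 3) / 2)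
        = ((m : ℝ) + 3) / 2 * Real.Gamma (((m : ℝ) + 3) / 2) := by
      rw [← Real.Gamma_add_one (by positivity)]
      push_cast
      ring_nf
    have hfac : ((m + 2 + 2).factorial : ℝ) = (m + 4) * (m + 3) * (m + 2).factorial := by
      simp only [Nat.factorial_succ (m + 2 + 1), Nat.factorial_succ (m + 2)]
      push_cast
      ring
    have hstep : Real.pi * (((m : ℝ) + 3) / 2) ≤ (2 / 3) ^ 2 * ((m + 4) * (m + 3)) := by
      have hm : (0 : ℝ) ≤ m := m.cast_nonneg
      nlinarith [Real.pi_lt_d2]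
    calc √Real.pi ^ (m + 2) * Real.Gamma ((((m + 2 : ℕ) : ℝ) + 3) / 2) / Real.Gamma (3 / 2)
        = Real.pi * (((m : ℝ) + 3) / 2)
            * (√Real.pi ^ m * Real.Gamma (((m : ℝ) + 3) / 2) / Real.Gamma (3 / 2)) := by
          rw [hrec, pow_add, Real.sq_sqrt Real.pi_pos.le]
          ring
      _ ≤ (2 / 3) ^ 2 * ((m + 4) * (m + 3)) * ((2 / 3 : ℝ) ^ m * (m + 2).factorial / 2) := by
          refine mul_le_mul hstep ih ?_ (by positivity)
          have := Real.Gamma_pos_of_pos (show (0 : ℝ) < ((m : ℝ) + 3) / 2 by positivity)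
          rw [hG]
          positivity
      _ = (2 / 3 : ℝ) ^ (m + 2) * (m + 2 + 2).factorial / 2 := by
          rw [hfac]
          ring

/-- For every `ℓ ≥ 2`, `(√π)^{ℓ−2} · Γ((ℓ+1)/2) / Γ(3/2) ≤ (2/3)^{ℓ−2} · ℓ!/2`. -/
theorem gamma_moment_ratio_le_factorial (ℓ : ℕ) (hℓ : 2 ≤ ℓ) :
    (Real.sqrt Real.pi) ^ (ℓ - 2) * Real.Gamma (((ℓ : ℝ) + 1) / 2)
        / Real.Gamma (3 / 2)
      ≤ (2 / 3 : ℝ) ^ (ℓ - 2) * (Nat.factorial ℓ) / 2 := by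
  obtain ⟨m, rfl⟩ := Nat.exists_eq_add_of_le' hℓ
  have h := sqrt_pi_pow_mul_Gamma_le m
  rwa [Nat.add_sub_cancel, show (((m + 2 : ℕ) : ℝ) + 1) / 2 = ((m : ℝ) + 3) / 2 by
    push_cast; ring]
end
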